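/- Chaitin's Omega number Z(1) = Ω = Σ_{p ∈ dom U} 2^{-|p|} is not strongly predictable. -/

import Mathlib

/-- The first `n` bits of the infinite binary sequence `X` (as a finite binary string). -/
def pre (X : ℕ → Bool) (n : ℕ) : List Bool := (List.range n).map X

/-- A martingale: nonnegative betting strategy with the fairness condition. -/
def IsMartingale (B : List Bool → ℝ) : Prop :=
  (∀ x, 0 ≤ B x) ∧ ∀ x, B (x ++ [false]) + B (x ++ [true]) = 2 * B x

/-- `B` succeeds on `X`: the capital along `X` is unbounded. -/
def Succeeds (B : List Bool → ℝ) (X : ℕ → Bool) : Prop := ∀ C : ℝ, ∃ n, C < B (pre X n)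

/-- A computable martingale: `{(x,q) | q < B x}` is decidable. -/
def ComputableMartingale (B : List Bool → ℝ) : Prop :=
  IsMartingale B ∧ ∃ g : List Bool × ℚ → Bool, Computable g ∧
    ∀ p : List Bool × ℚ, g p = true ↔ (p.2 : ℝ) < B p.1

def ComputablyRandom (X : ℕ → Bool) : Prop :=
  ∀ B : List Bool → ℝ, ComputableMartingale B → ¬ Succeeds B X

def TotalStronglyPredictable (X : ℕ → Bool) : Prop :=
  ∃ F : List Bool → Option Bool, Computable F ∧
    (∀ n b, F (pre X n) = some b → b = X n) ∧
    {n : ℕ | F (pre X n) ≠ none}.Infinite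

def StronglyPredictable (X : ℕ → Bool) : Prop :=
  ∃ F : List Bool →. Option Bool, Partrec F ∧
    (∀ n, (F (pre X n)).Dom) ∧
    (∀ n b, some b ∈ F (pre X n) → b = X n) ∧
    {n : ℕ | ∃ b, some b ∈ F (pre X n)}.Infinite

def PartialComputableMartingale (B : List Bool →. ℚ) : Prop :=
  Partrec B ∧
  (∀ x q, q ∈ B x → 0 ≤ q) ∧
  (∀ x y : List Bool, x <+: y → (B y).Dom → (B x).Dom) ∧
  (∀ x : List Bool, (B x).Dom → ((B (x ++ [false])).Dom ↔ (B (x ++ [true])).Dom)) ∧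
  (∀ (x : List Bool) (q q₀ q₁ : ℚ), q ∈ B x → q₀ ∈ B (x ++ [false]) → q₁ ∈ B (x ++ [true]) →
    q₀ + q₁ = 2 * q)

def PSucceeds (B : List Bool →. ℚ) (X : ℕ → Bool) : Prop :=
  (∀ n, (B (pre X n)).Dom) ∧ ∀ C : ℚ, ∃ n, ∃ q ∈ B (pre X n), C < q

def PartialComputablyRandom (X : ℕ → Bool) : Prop :=
  ∀ B : List Bool →. ℚ, PartialComputableMartingale B → ¬ PSucceeds B X

def FiniteStateStronglyPredictable (X : ℕ → Bool) : Prop :=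
  ∃ (Q : Type) (_ : Fintype Q) (δ : Q → Bool → Q) (q₀ : Q) (f : Q → Option Bool),
    (∀ n b, f ((pre X n).foldl δ q₀) = some b → b = X n) ∧
    {n : ℕ | f ((pre X n).foldl δ q₀) ≠ none}.Infinite

/-- A prefix-free machine: a partial computable function with prefix-free domain. -/
def IsPrefixFreeMachine (M : List Bool →. List Bool) : Prop :=
  Partrec M ∧ ∀ p q : List Bool, (M p).Dom → (M q).Dom → p <+: q → p = q

/-- An optimal prefix-free machine. -/
def IsOptimalMachine (U : List Bool →. List Bool) : Prop :=
  IsPrefixFreeMachine U ∧ ∀ M : List Bool →. List Bool, IsPrefixFreeMachine M →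
    ∃ d : ℕ, ∀ p : List Bool, (M p).Dom →
      ∃ q : List Bool, q.length ≤ p.length + d ∧ U q = M p

/-- Program-size (Kolmogorov) complexity of `x` with respect to `U`. -/
noncomputable def KC (U : List Bool →. List Bool) (x : List Bool) : ℕ :=
  sInf {n : ℕ | ∃ p : List Bool, p.length = n ∧ x ∈ U p}

/-- The partition function `Z(T)` of `U` at temperature `T`. -/
noncomputable def ZT (U : List Bool →. List Bool) (T : ℝ) : ℝ :=
  ∑' p : {p : List Bool // (U p).Dom}, (2 : ℝ) ^ (-((p.1.length : ℝ)) / T)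

/-- Chaitin's Ω number of `U`. -/
noncomputable def Omega (U : List Bool →. List Bool) : ℝ :=
  ∑' p : {p : List Bool // (U p).Dom}, (2 : ℝ) ^ (-((p.1.length : ℝ)))

/-- The `n`-th bit (0-indexed) of the base-two expansion (with infinitely many zeros)
of the fractional part of `α`. -/
noncomputable def binDigit (α : ℝ) (n : ℕ) : Bool :=
  decide (⌊α * 2 ^ (n + 1)⌋ % 2 = 1)

def ComputableReal (T : ℝ) : Prop :=
  ∃ f : ℕ → ℚ, Computable f ∧ ∀ n : ℕ, |T - (f n : ℝ)| < (2 : ℝ) ^ (-(n : ℤ))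

def WeaklyChaitinRandom (U : List Bool →. List Bool) (X : ℕ → Bool) : Prop :=
  ∃ c : ℕ, ∀ n : ℕ, 1 ≤ n → (n : ℤ) - c ≤ (KC U (pre X n) : ℤ)

def WeaklyChaitinTRandom (U : List Bool →. List Bool) (T : ℝ) (X : ℕ → Bool) : Prop :=
  ∃ c : ℕ, ∀ n : ℕ, 1 ≤ n → T * n - c ≤ (KC U (pre X n) : ℝ)

def StrictlyTCompressible (U : List Bool →. List Bool) (T : ℝ) (X : ℕ → Bool) : Prop :=
  ∃ d : ℕ, ∀ n : ℕ, 1 ≤ n → (KC U (pre X n) : ℝ) ≤ T * n + d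

def StrictlyChaitinTRandom (U : List Bool →. List Bool) (T : ℝ) (X : ℕ → Bool) : Prop :=
  WeaklyChaitinTRandom U T X ∧ StrictlyTCompressible U T X


/-- Step-bounded approximations of a partial recursive function. -/
theorem exists_approx {α σ : Type} [Primcodable α] [Primcodable σ] {f : α →. σ} (hf : Partrec f) :
    ∃ g : ℕ → α → Option σ, Primrec₂ g ∧
      (∀ s t a b, s ≤ t → g s a = some b → g t a = some b) ∧
      ∀ a b, b ∈ f a ↔ ∃ t, g t a = some b := by
  obtain ⟨c, hc⟩ := Nat.Partrec.Code.exists_code.1 hf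
  refine ⟨fun t a => (Nat.Partrec.Code.evaln t c (Encodable.encode a)).bind
    (fun n => (Encodable.decode n : Option σ)), ?_, ?_, ?_⟩
  · have h : Primrec fun q : ℕ × α =>
        Nat.Partrec.Code.evaln q.1 c (Encodable.encode q.2) :=
      Nat.Partrec.Code.primrec_evaln.comp
        ((Primrec.fst.pair (Primrec.const c)).pair (Primrec.encode.comp Primrec.snd))
    exact Primrec.option_bind h (Primrec.decode.comp Primrec.snd)
  · intro s t a b hst h
    rw [Option.bind_eq_some_iff] at h ⊢
    obtain ⟨n, h1, h2⟩ := h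
    exact ⟨n, Nat.Partrec.Code.evaln_mono hst h1, h2⟩
  · intro a b
    have key : ∀ n, (∃ t, n ∈ Nat.Partrec.Code.evaln t c (Encodable.encode a)) ↔
        ∃ b ∈ f a, Encodable.encode b = n := by
      intro n
      rw [← Nat.Partrec.Code.evaln_complete, hc]
      simp
    constructor
    · intro hb
      obtain ⟨t, ht⟩ := (key (Encodable.encode b)).2 ⟨b, hb, rfl⟩
      refine ⟨t, ?_⟩
      rw [Option.bind_eq_some_iff]
      exact ⟨_, ht, Encodable.encodek b⟩
    · rintro ⟨t, ht⟩
      rw [Option.bind_eq_some_iff] at ht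
      obtain ⟨n, h1, h2⟩ := ht
      obtain ⟨b', hmem, rfl⟩ := (key n).1 ⟨t, h1⟩
      rw [Encodable.encodek] at h2
      cases h2
      exact hmem

/-- Kraft inequality, in the form of summability over the domain. -/
theorem summable_dom {U : List Bool →. List Bool} (hU : IsPrefixFreeMachine U) :
    Summable (fun p : {p : List Bool // (U p).Dom} => (2 : ℝ) ^ (-((p.1.length : ℝ)))) := by
  classical
  by_cases h0 : (U []).Dom
  · have : Subsingleton {p : List Bool // (U p).Dom} := by
      constructor
      rintro ⟨p, hp⟩ ⟨q, hq⟩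
      have h1 := hU.2 [] p h0 hp List.nil_prefix
      have h2 := hU.2 [] q h0 hq List.nil_prefix
      subst h1; subst h2; rfl
    exact Summable.of_finite
  · refine summable_of_sum_le (c := 1) (fun p => by positivity) ?_
    intro u
    have hud : InformationTheory.UniquelyDecodable
        ((u.map ⟨Subtype.val, Subtype.val_injective⟩ : Finset (List Bool)) : Set (List Bool)) := by
      have hS : ∀ w ∈ ((u.map ⟨Subtype.val, Subtype.val_injective⟩ : Finset (List Bool)) :
          Set (List Bool)), (U w).Dom := by
        intro w hw
        simp at hw
        exact hw.1
      intro L₁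
      induction L₁ with
      | nil =>
        intro L₂ _ h2 h
        cases L₂ with
        | nil => rfl
        | cons w L =>
          exfalso
          simp at h
          have := hS w (h2 w (by simp))
          rw [h.1] at this
          exact h0 this
      | cons w L ih =>
        intro L₂ h1 h2 h
        cases L₂ with
        | nil =>
          exfalso
          simp at h
          have := hS w (h1 w (by simp))
          rw [h.1] at this
          exact h0 this
        | cons w' L' =>
          have hw := hS w (h1 w (by simp))
          have hw' := hS w' (h2 w' (by simp))
          simp only [List.flatten_cons] at h
          have hpre : w = w' := by
            have a1 : w <+: w' ++ L'.flatten := h ▸ List.prefix_append _ _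
            rcases List.prefix_or_prefix_of_prefix a1 (List.prefix_append w' _) with h' | h'
            · exact hU.2 _ _ hw hw' h'
            · exact (hU.2 _ _ hw' hw h').symm
          subst hpre
          rw [ih L' (fun x hx => h1 x (by simp [hx])) (fun x hx => h2 x (by simp [hx]))
            (List.append_cancel_left h)]
    have := InformationTheory.kraft_mcmillan_inequality hud
    rw [Finset.sum_map] at this
    refine le_trans (le_of_eq ?_) this
    refine Finset.sum_congr rfl fun p _ => ?_
    simp [Real.rpow_neg, Real.rpow_natCast]

/-- Description relation for a (reversed) predictor. -/
inductive Desc (F : List Bool →. Option Bool) : List Bool → List Bool → ℕ → Prop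
  | nil : Desc F [] [] 0
  | stepN {r s c} (b : Bool) : Desc F r s c → none ∈ F r → Desc F (b :: r) (b :: s) c
  | stepP {r s c} (b : Bool) : Desc F r s c → some b ∈ F r → Desc F (b :: r) s (c + 1)

theorem Desc.length {F r s c} (h : Desc F r s c) : r.length = s.length + c := by
  induction h with
  | nil => rfl
  | stepN b _ _ ih => simp; omega
  | stepP b _ _ ih => simp; omega

theorem Desc.det {F r s c} (h : Desc F r s c) : ∀ {s' c'}, Desc F r s' c' → s = s' ∧ c = c' := by
  induction h with
  | nil => intro s' c' h'; cases h'; exact ⟨rfl, rfl⟩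
  | stepN b h0 hn ih =>
    intro s' c' h'
    cases h' with
    | stepN _ h1 hn1 => obtain ⟨rfl, rfl⟩ := ih h1; exact ⟨rfl, rfl⟩
    | stepP _ h1 hn1 => exact absurd (Part.mem_unique hn hn1) (by simp)
  | stepP b h0 hn ih =>
    intro s' c' h'
    cases h' with
    | stepN _ h1 hn1 => exact absurd (Part.mem_unique hn hn1) (by simp)
    | stepP _ h1 hn1 => obtain ⟨rfl, rfl⟩ := ih h1; exact ⟨rfl, rfl⟩

theorem Desc.trunc {F r} (w : List Bool) : ∀ {s c}, Desc F (w ++ r) s c →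
    ∃ s0 c0, Desc F r s0 c0 ∧ s0 <:+ s ∧ c0 ≤ c := by
  induction w with
  | nil => intro s c h; exact ⟨s, c, h, List.suffix_rfl, le_rfl⟩
  | cons b w ih =>
    intro s c h
    cases h with
    | stepN _ h1 _ =>
      obtain ⟨s0, c0, h2, h3, h4⟩ := ih h1
      exact ⟨s0, c0, h2, h3.trans (List.suffix_cons _ _), h4⟩
    | stepP _ h1 _ =>
      obtain ⟨s0, c0, h2, h3, h4⟩ := ih h1
      exact ⟨s0, c0, h2, h3, by omega⟩

theorem suffix_cons_split {r0 r' : List Bool} (h : r0 <:+ r') :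
    r' = r0 ∨ ∃ w b, r' = w ++ b :: r0 := by
  obtain ⟨w, rfl⟩ := h
  rcases List.eq_nil_or_concat w with rfl | ⟨w', b, rfl⟩
  · left; rfl
  · right; exact ⟨w', b, by simp⟩

theorem comparable_trans {s0 s s' : List Bool} (h0 : s0 <:+ s) (h : s <:+ s' ∨ s' <:+ s) :
    s0 <:+ s' ∨ s' <:+ s0 := by
  rcases h with h | h
  · exact Or.inl (h0.trans h)
  · exact List.suffix_or_suffix_of_suffix h0 h

theorem Desc.comparable {F r s c} (h : Desc F r s c) : ∀ {r' s' c'}, Desc F r' s' c' →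
    (s <:+ s' ∨ s' <:+ s) → (r <:+ r' ∨ r' <:+ r) := by
  induction h with
  | nil => intro r' s' c' _ _; exact Or.inl (List.nil_suffix)
  | @stepN r0 s0 c0 b h0 hn ih =>
    intro r' s' c' h' hs
    rcases ih h' (comparable_trans (List.suffix_cons b s0) hs) with h1 | h1
    · rcases suffix_cons_split h1 with rfl | ⟨w, b', rfl⟩
      · exact Or.inr (List.suffix_cons _ _)
      · obtain ⟨s1, c1, h2, h3, h4⟩ := h'.trunc w
        cases h2 with
        | @stepN _ s2 _ _ h5 _ =>
          obtain ⟨rfl, rfl⟩ := h0.det h5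
          have h6 := (comparable_trans h3 hs.symm)
          have : b = b' := by
            rcases h6 with h6 | h6
            · have := h6.eq_of_length (by simp); simp at this; exact this.symm
            · have := h6.eq_of_length (by simp); simp at this; exact this
          subst this
          exact Or.inl (List.suffix_append _ _)
        | stepP _ h5 hp => exact absurd (Part.mem_unique hn hp) (by simp)
    · exact Or.inr (h1.trans (List.suffix_cons _ _))
  | @stepP r0 s0 c0 b h0 hn ih =>
    intro r' s' c' h' hs
    rcases ih h' hs with h1 | h1
    · rcases suffix_cons_split h1 with rfl | ⟨w, b', rfl⟩
      · exact Or.inr (List.suffix_cons _ _)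
      · obtain ⟨s1, c1, h2, h3, h4⟩ := h'.trunc w
        cases h2 with
        | stepN _ h5 hp => exact absurd (Part.mem_unique hn hp) (by simp)
        | stepP _ h5 hp =>
          have := Part.mem_unique hn hp
          simp at this
          subst this
          exact Or.inl (List.suffix_append _ _)
    · exact Or.inr (h1.trans (List.suffix_cons _ _))

theorem Desc.eq_of_suffix {F r s c} (h : Desc F r s c) {r' s'} (h' : Desc F r' s' c)
    (hr : ∃ b, some b ∈ F r) (hs : r <:+ r') : r = r' := by
  rcases suffix_cons_split hs with rfl | ⟨w, b', rfl⟩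
  · rfl
  · obtain ⟨b, hb⟩ := hr
    obtain ⟨s1, c1, h2, h3, h4⟩ := h'.trunc w
    cases h2 with
    | stepN _ h5 hp => exact absurd (Part.mem_unique hb hp) (by simp)
    | stepP _ h5 hp =>
      obtain ⟨rfl, rfl⟩ := h.det h5
      omega

/-- Uniqueness of the described string. -/
theorem Desc.unique {F r s c r' s'} (h : Desc F r s c) (h' : Desc F r' s' c)
    (hr : ∃ b, some b ∈ F r) (hr' : ∃ b, some b ∈ F r')
    (hs : s <:+ s') : r = r' := by
  rcases h.comparable h' (Or.inl hs) with h1 | h1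
  · exact h.eq_of_suffix h' hr h1
  · exact (h'.eq_of_suffix h hr' h1).symm

noncomputable def strip (g : ℕ → List Bool → Option (Option Bool)) (t : ℕ) (r : List Bool) :
    Option (List Bool × ℕ) :=
  List.recOn r (some ([], 0)) fun b l IH => IH.bind fun sc => (g t l).bind fun o =>
    Option.casesOn o (some (b :: sc.1, sc.2))
      (fun b' => if b = b' then some (sc.1, sc.2 + 1) else none)

theorem strip_primrec {g : ℕ → List Bool → Option (Option Bool)} (hg : Primrec₂ g) :
    Primrec₂ (strip g) := by
  have h3 : Primrec fun z : (((((ℕ × List Bool) × (Bool × List Bool × Option (List Bool × ℕ))) ×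
      (List Bool × ℕ)) × Option Bool) × Bool) =>
      (if z.1.1.1.2.1 = z.2 then some (z.1.1.2.1, z.1.1.2.2 + 1) else none :
        Option (List Bool × ℕ)) := by
    refine Primrec.ite ?_ ?_ ?_
    · exact Primrec.eq.comp (Primrec.fst.comp (Primrec.snd.comp (Primrec.fst.comp
        (Primrec.fst.comp Primrec.fst)))) Primrec.snd
    · refine Primrec.option_some.comp (Primrec.pair ?_ (Primrec.succ.comp ?_))
      · exact Primrec.fst.comp (Primrec.snd.comp (Primrec.fst.comp Primrec.fst))
      · exact Primrec.snd.comp (Primrec.snd.comp (Primrec.fst.comp Primrec.fst))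
    · exact Primrec.const none
  have h2 : Primrec fun z : ((((ℕ × List Bool) × (Bool × List Bool × Option (List Bool × ℕ))) ×
      (List Bool × ℕ)) × Option Bool) =>
      (Option.casesOn z.2 (some (z.1.1.2.1 :: z.1.2.1, z.1.2.2))
      (fun b' => if z.1.1.2.1 = b' then some (z.1.2.1, z.1.2.2 + 1) else none) :
        Option (List Bool × ℕ)) := by
    refine Primrec.option_casesOn Primrec.snd ?_ h3
    refine Primrec.option_some.comp (Primrec.pair (Primrec.list_cons.comp ?_ ?_) ?_)
    · exact Primrec.fst.comp (Primrec.snd.comp (Primrec.fst.comp Primrec.fst))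
    · exact Primrec.fst.comp (Primrec.snd.comp Primrec.fst)
    · exact Primrec.snd.comp (Primrec.snd.comp Primrec.fst)
  have h1 : Primrec fun z : (((ℕ × List Bool) × (Bool × List Bool × Option (List Bool × ℕ))) ×
      (List Bool × ℕ)) => (g z.1.1.1 z.1.2.2.1).bind fun o =>
      (Option.casesOn o (some (z.1.2.1 :: z.2.1, z.2.2))
      (fun b' => if z.1.2.1 = b' then some (z.2.1, z.2.2 + 1) else none) :
        Option (List Bool × ℕ)) := by
    refine Primrec.option_bind (hg.comp ?_ ?_) h2
    · exact Primrec.fst.comp (Primrec.fst.comp Primrec.fst)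
    · exact Primrec.fst.comp (Primrec.snd.comp (Primrec.snd.comp Primrec.fst))
  have h0 : Primrec fun z : ((ℕ × List Bool) × (Bool × List Bool × Option (List Bool × ℕ))) =>
      z.2.2.2.bind fun sc => (g z.1.1 z.2.2.1).bind fun o =>
      (Option.casesOn o (some (z.2.1 :: sc.1, sc.2))
      (fun b' => if z.2.1 = b' then some (sc.1, sc.2 + 1) else none) :
        Option (List Bool × ℕ)) :=
    Primrec.option_bind (Primrec.snd.comp (Primrec.snd.comp Primrec.snd)) h1
  exact Primrec.list_rec (f := fun z : ℕ × List Bool => z.2) (g := fun _ => some ([], 0))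
    Primrec.snd (Primrec.const _) h0.to₂

theorem strip_desc {F : List Bool →. Option Bool} {g : ℕ → List Bool → Option (Option Bool)}
    (hs : ∀ t a b, g t a = some b → b ∈ F a) (t : ℕ) :
    ∀ r s c, strip g t r = some (s, c) → Desc F r s c := by
  intro r
  induction r with
  | nil =>
    intro s c h
    simp only [strip, Option.some.injEq, Prod.mk.injEq] at h
    obtain ⟨rfl, rfl⟩ := h
    exact Desc.nil
  | cons b r ih =>
    intro s c h
    change (strip g t r).bind _ = _ at h
    rw [Option.bind_eq_some_iff] at h
    obtain ⟨⟨s0, c0⟩, h1, h⟩ := h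
    rw [Option.bind_eq_some_iff] at h
    obtain ⟨o, h2, h⟩ := h
    cases o with
    | none =>
      simp only [Option.some.injEq, Prod.mk.injEq] at h
      obtain ⟨rfl, rfl⟩ := h
      exact Desc.stepN b (ih _ _ h1) (hs _ _ _ h2)
    | some b' =>
      simp only at h
      split_ifs at h with hb
      subst hb
      simp only [Option.some.injEq, Prod.mk.injEq] at h
      obtain ⟨rfl, rfl⟩ := h
      exact Desc.stepP b (ih _ _ h1) (hs _ _ _ h2)

theorem desc_strip {F : List Bool →. Option Bool} {g : ℕ → List Bool → Option (Option Bool)}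
    (hm : ∀ s t a b, s ≤ t → g s a = some b → g t a = some b)
    (hc : ∀ a b, b ∈ F a ↔ ∃ t, g t a = some b) {r s c} (h : Desc F r s c) :
    ∃ t0, ∀ t, t0 ≤ t → strip g t r = some (s, c) := by
  induction h with
  | nil => exact ⟨0, fun t _ => rfl⟩
  | stepN b h0 hn ih =>
    obtain ⟨t0, ht0⟩ := ih
    obtain ⟨t1, ht1⟩ := (hc _ _).1 hn
    refine ⟨max t0 t1, fun t ht => ?_⟩
    change (strip g t _).bind _ = _
    rw [ht0 t (le_trans (le_max_left _ _) ht), Option.bind_some,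
      hm t1 t _ _ (le_trans (le_max_right _ _) ht) ht1, Option.bind_some]
  | stepP b h0 hn ih =>
    obtain ⟨t0, ht0⟩ := ih
    obtain ⟨t1, ht1⟩ := (hc _ _).1 hn
    refine ⟨max t0 t1, fun t ht => ?_⟩
    change (strip g t _).bind _ = _
    rw [ht0 t (le_trans (le_max_left _ _) ht), Option.bind_some,
      hm t1 t _ _ (le_trans (le_max_right _ _) ht) ht1, Option.bind_some]
    simp

/-- integer value of a reversed bit string with leading integer part `a` -/
def bval (a : ℕ) (r : List Bool) : ℕ := List.rec a (fun b _ IH => 2 * IH + b.toNat) r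

theorem bval_primrec (a : ℕ) : Primrec (bval a) := by
  have : Primrec fun z : List Bool × (Bool × List Bool × ℕ) => 2 * z.2.2.2 + z.2.1.toNat := by
    refine Primrec.nat_add.comp (Primrec.nat_mul.comp (Primrec.const 2) ?_)
      ((Primrec.dom_bool _).comp ?_)
    · exact Primrec.snd.comp (Primrec.snd.comp Primrec.snd)
    · exact Primrec.fst.comp Primrec.snd
  exact Primrec.list_rec (f := fun z : List Bool => z) (g := fun _ => a)
    Primrec.id (Primrec.const _) this.to₂

theorem sum_primrec {h : ℕ → ℕ → ℕ} (hh : Primrec₂ h) :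
    Primrec fun t => ∑ i ∈ Finset.range t, h t i := by
  have : Primrec fun t : ℕ => (Nat.rec 0 (fun i IH => IH + h t i) t : ℕ) := by
    refine Primrec.nat_rec' (f := fun t => t) (g := fun _ => 0)
      (h := fun t z => z.2 + h t z.1) Primrec.id (Primrec.const 0) ?_
    exact Primrec.nat_add.comp (Primrec.snd.comp Primrec.snd)
      (hh.comp Primrec.fst (Primrec.fst.comp Primrec.snd))
  refine this.of_eq fun t => ?_
  have : ∀ n, (Nat.rec 0 (fun i IH => IH + h t i) n : ℕ) = ∑ i ∈ Finset.range n, h t i := by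
    intro n
    induction n with
    | zero => rfl
    | succ n ih => rw [Finset.sum_range_succ, ← ih]
  exact this t

theorem pow2_primrec : Primrec fun n : ℕ => 2 ^ n := by
  have : Primrec fun t : ℕ => (Nat.rec 1 (fun _ IH => 2 * IH) t : ℕ) := by
    refine Primrec.nat_rec' (f := fun t => t) (g := fun _ => 1)
      (h := fun t z => 2 * z.2) Primrec.id (Primrec.const 1) ?_
    exact Primrec.nat_mul.comp (Primrec.const 2) (Primrec.snd.comp Primrec.snd)
  refine this.of_eq fun t => ?_
  induction t with
  | zero => rfl
  | succ n ih => rw [pow_succ, ← ih]; ring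

def sterm (u : ℕ → List Bool → Option (List Bool)) (t i : ℕ) : ℕ :=
  ((Encodable.decode₂ (List Bool) i).bind fun p => (u t p).bind fun _ =>
    if p.length ≤ t then some (2 ^ (t - p.length)) else none).getD 0

def ssum (u : ℕ → List Bool → Option (List Bool)) (t : ℕ) : ℕ :=
  ∑ i ∈ Finset.range t, sterm u t i

def oterm (u : ℕ → List Bool → Option (List Bool)) (t i : ℕ) : ℕ :=
  (((Encodable.decode₂ (List Bool) i).bind fun p => u t p).getD []).length

def out (u : ℕ → List Bool → Option (List Bool)) (t : ℕ) : List Bool :=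
  true :: (List.range (∑ i ∈ Finset.range t, oterm u t i)).map fun _ => true

theorem ssum_primrec {u : ℕ → List Bool → Option (List Bool)} (hu : Primrec₂ u) :
    Primrec (ssum u) := by
  refine sum_primrec (h := sterm u) ?_
  have h2 : Primrec fun z : (((ℕ × ℕ) × List Bool) × List Bool) =>
      (if z.1.2.length ≤ z.1.1.1 then some (2 ^ (z.1.1.1 - z.1.2.length)) else none :
        Option ℕ) := by
    have hl : Primrec fun z : (((ℕ × ℕ) × List Bool) × List Bool) => z.1.2.length :=
      Primrec.list_length.comp (Primrec.snd.comp Primrec.fst)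
    have ht : Primrec fun z : (((ℕ × ℕ) × List Bool) × List Bool) => z.1.1.1 :=
      Primrec.fst.comp (Primrec.fst.comp Primrec.fst)
    exact Primrec.ite (Primrec.nat_le.comp hl ht)
      (Primrec.option_some.comp (pow2_primrec.comp (Primrec.nat_sub.comp ht hl)))
      (Primrec.const none)
  have h1 : Primrec fun z : ((ℕ × ℕ) × List Bool) => (u z.1.1 z.2).bind fun _ =>
      (if z.2.length ≤ z.1.1 then some (2 ^ (z.1.1 - z.2.length)) else none : Option ℕ) :=
    Primrec.option_bind (hu.comp (Primrec.fst.comp Primrec.fst) Primrec.snd) h2.to₂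
  exact Primrec.option_getD.comp (Primrec.option_bind (Primrec.decode₂.comp Primrec.snd) h1.to₂)
    (Primrec.const 0)

theorem out_primrec {u : ℕ → List Bool → Option (List Bool)} (hu : Primrec₂ u) :
    Primrec (out u) := by
  have : Primrec fun t => ∑ i ∈ Finset.range t, oterm u t i := by
    refine sum_primrec (h := oterm u) ?_
    have h1 : Primrec fun z : ((ℕ × ℕ) × List Bool) => u z.1.1 z.2 :=
      hu.comp (Primrec.fst.comp Primrec.fst) Primrec.snd
    exact Primrec.list_length.comp (Primrec.option_getD.comp
      (Primrec.option_bind (Primrec.decode₂.comp Primrec.snd) h1.to₂) (Primrec.const []))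
  exact Primrec.list_cons.comp (Primrec.const true)
    (Primrec.list_map (Primrec.list_range.comp this) (Primrec.const true).to₂)

theorem out_ne {u : ℕ → List Bool → Option (List Bool)} {t : ℕ} {q : List Bool}
    (hi : Encodable.encode q < t) : u t q ≠ some (out u t) := by
  intro h
  have h1 := Finset.single_le_sum (s := Finset.range t)
    (f := oterm u t) (fun _ _ => Nat.zero_le _) (Finset.mem_range.2 hi)
  have h3 : oterm u t (Encodable.encode q) = (out u t).length := by
    simp [oterm, h]
  have h2 : (out u t).length = (∑ i ∈ Finset.range t, oterm u t i) + 1 := by simp [out]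
  omega

def header (j : ℕ) (s : List Bool) : List Bool :=
  (List.range j).map (fun _ => true) ++ false :: s.reverse

theorem header_primrec : Primrec₂ header := by
  refine Primrec.list_append.comp (Primrec.list_map (Primrec.list_range.comp Primrec.fst)
    (Primrec.const true)) (Primrec.list_cons.comp (Primrec.const false)
    (Primrec.list_reverse.comp Primrec.snd))

theorem header_prefix {j j' : ℕ} {s s' : List Bool} (h : header j s <+: header j' s') :
    j = j' ∧ s <:+ s' := by
  have e : ∀ j s, header j s = List.replicate j true ++ false :: s.reverse := by
    intro j s; simp [header]
  rw [e, e] at h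
  clear e
  induction j generalizing j' with
  | zero =>
    cases j' with
    | zero => simpa [List.reverse_prefix] using h
    | succ j' => simp [List.replicate_succ] at h
  | succ j ih =>
    cases j' with
    | zero => simp [List.replicate_succ] at h
    | succ j' =>
      simp only [List.replicate_succ, List.cons_append, List.cons_prefix_cons, true_and] at h
      obtain ⟨h1, h2⟩ := ih h
      exact ⟨by rw [h1], h2⟩

/-- The conditions checked by the machine. -/
def Good (u : ℕ → List Bool → Option (List Bool)) (a : ℕ) (p r : List Bool) (j t : ℕ)
    (sc : List Bool × ℕ) (o : Option Bool) : Prop :=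
  o.isSome = true ∧ sc.2 = 2 * j ∧ p = header j sc.1 ∧
    bval a r * 2 ^ t < ssum u t * 2 ^ r.length + 2 ^ t

instance (u a p r j t sc o) : Decidable (Good u a p r j t sc o) := by
  unfold Good; infer_instance

noncomputable def mfun (g : ℕ → List Bool → Option (Option Bool))
    (u : ℕ → List Bool → Option (List Bool)) (a : ℕ) (p : List Bool) (n : ℕ) :
    Option (List Bool) :=
  (Encodable.decode n : Option (List Bool × ℕ × ℕ)).bind fun w =>
    (strip g w.2.2 w.1).bind fun sc => (g w.2.2 w.1).bind fun o =>
      if Good u a p w.1 w.2.1 w.2.2 sc o then some (out u w.2.2) else none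

theorem mfun_primrec {g : ℕ → List Bool → Option (Option Bool)} (hg : Primrec₂ g)
    {u : ℕ → List Bool → Option (List Bool)} (hu : Primrec₂ u) (a : ℕ) :
    Primrec₂ (mfun g u a) := by
  have h3 : Primrec fun z : ((((List Bool × ℕ) × (List Bool × ℕ × ℕ)) × (List Bool × ℕ)) ×
      Option Bool) => (if Good u a z.1.1.1.1 z.1.1.2.1 z.1.1.2.2.1 z.1.1.2.2.2 z.1.2 z.2
        then some (out u z.1.1.2.2.2) else none) := by
    have hw : Primrec fun z : ((((List Bool × ℕ) × (List Bool × ℕ × ℕ)) × (List Bool × ℕ)) ×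
      Option Bool) => z.1.1.2 := Primrec.snd.comp (Primrec.fst.comp Primrec.fst)
    have hr := Primrec.fst.comp hw
    have hj := Primrec.fst.comp (Primrec.snd.comp hw)
    have ht := Primrec.snd.comp (Primrec.snd.comp hw)
    have hp : Primrec fun z : ((((List Bool × ℕ) × (List Bool × ℕ × ℕ)) × (List Bool × ℕ)) ×
      Option Bool) => z.1.1.1.1 :=
      Primrec.fst.comp (Primrec.fst.comp (Primrec.fst.comp Primrec.fst))
    have hsc : Primrec fun z : ((((List Bool × ℕ) × (List Bool × ℕ × ℕ)) × (List Bool × ℕ)) ×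
      Option Bool) => z.1.2 := Primrec.snd.comp Primrec.fst
    refine Primrec.ite (PrimrecPred.and ?_ (PrimrecPred.and ?_ (PrimrecPred.and ?_ ?_)))
      (Primrec.option_some.comp ((out_primrec hu).comp ht)) (Primrec.const none)
    · exact Primrec.eq.comp (Primrec.option_isSome.comp Primrec.snd) (Primrec.const true)
    · exact Primrec.eq.comp (Primrec.snd.comp hsc)
        (Primrec.nat_mul.comp (Primrec.const 2) hj)
    · exact Primrec.eq.comp hp (header_primrec.comp hj (Primrec.fst.comp hsc))
    · refine Primrec.nat_lt.comp
        (Primrec.nat_mul.comp ((bval_primrec a).comp hr) (pow2_primrec.comp ht))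
        (Primrec.nat_add.comp (Primrec.nat_mul.comp ((ssum_primrec hu).comp ht)
          (pow2_primrec.comp (Primrec.list_length.comp hr))) (pow2_primrec.comp ht))
  refine Primrec.option_bind (Primrec.decode.comp Primrec.snd) ?_
  refine Primrec.option_bind ((strip_primrec hg).comp
    (Primrec.snd.comp (Primrec.snd.comp Primrec.snd)) (Primrec.fst.comp Primrec.snd)) ?_
  refine Primrec.option_bind (hg.comp
    (Primrec.snd.comp (Primrec.snd.comp (Primrec.snd.comp Primrec.fst)))
    (Primrec.fst.comp (Primrec.snd.comp Primrec.fst))) ?_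
  exact h3

theorem mfun_spec {F : List Bool →. Option Bool} {g : ℕ → List Bool → Option (Option Bool)}
    (hs : ∀ t a b, g t a = some b → b ∈ F a)
    {u : ℕ → List Bool → Option (List Bool)} {a : ℕ} {p y : List Bool} {n : ℕ}
    (h : mfun g u a p n = some y) : ∃ r s j t, Desc F r s (2 * j) ∧ (∃ b, some b ∈ F r) ∧
      p = header j s ∧ bval a r * 2 ^ t < ssum u t * 2 ^ r.length + 2 ^ t ∧ y = out u t := by
  unfold mfun at h
  rw [Option.bind_eq_some_iff] at h
  obtain ⟨⟨r, j, t⟩, -, h⟩ := h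
  rw [Option.bind_eq_some_iff] at h
  obtain ⟨⟨s, c⟩, h1, h⟩ := h
  rw [Option.bind_eq_some_iff] at h
  obtain ⟨o, h2, h⟩ := h
  split_ifs at h with hG
  obtain ⟨g1, g2, g3, g4⟩ := hG
  simp only at g1 g2 g3 g4 h h1 h2
  subst g2
  obtain ⟨b, rfl⟩ := Option.isSome_iff_exists.1 g1
  exact ⟨r, s, j, t, strip_desc hs t _ _ _ h1, ⟨b, hs _ _ _ h2⟩, g3, g4, by simpa using h.symm⟩

theorem machine_prefixFree {F : List Bool →. Option Bool}
    {g : ℕ → List Bool → Option (Option Bool)} (hg : Primrec₂ g)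
    (hs : ∀ t a b, g t a = some b → b ∈ F a)
    {u : ℕ → List Bool → Option (List Bool)} (hu : Primrec₂ u) (a : ℕ) :
    IsPrefixFreeMachine (fun p => Nat.rfindOpt (mfun g u a p)) := by
  refine ⟨Partrec.rfindOpt (mfun_primrec hg hu a).to_comp, ?_⟩
  intro p q hp hq hpq
  rw [Nat.rfindOpt_dom] at hp hq
  obtain ⟨n, y, h⟩ := hp
  obtain ⟨n', y', h'⟩ := hq
  obtain ⟨r, s, j, t, d1, d2, rfl, -, -⟩ := mfun_spec hs h
  obtain ⟨r', s', j', t', d1', d2', rfl, -, -⟩ := mfun_spec hs h'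
  obtain ⟨rfl, hss⟩ := header_prefix hpq
  obtain rfl := d1.unique d1' d2 d2' hss
  have hfin := (d1.det d1').1
  rw [hfin]

/-- weight of the `i`-th program -/
noncomputable def wt (U : List Bool →. List Bool) : ℕ → ℝ :=
  Function.extend (fun p : {p : List Bool // (U p).Dom} => Encodable.encode p.1)
    (fun p => (2 : ℝ) ^ (-((p.1.length : ℝ)))) 0

theorem enc_inj (U : List Bool →. List Bool) :
    Function.Injective (fun p : {p : List Bool // (U p).Dom} => Encodable.encode p.1) :=
  fun _ _ h => Subtype.ext (Encodable.encode_injective h)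

theorem wt_hasSum {U : List Bool →. List Bool} (hU : IsPrefixFreeMachine U) :
    HasSum (wt U) (Omega U) :=
  (hasSum_extend_zero (enc_inj U)).2 (summable_dom hU).hasSum

theorem wt_enc {U : List Bool →. List Bool} {p : List Bool} (hp : (U p).Dom) :
    wt U (Encodable.encode p) = ((2 : ℝ) ^ p.length)⁻¹ := by
  have := (enc_inj U).extend_apply (fun p => (2 : ℝ) ^ (-((p.1.length : ℝ)))) 0 ⟨p, hp⟩
  rw [wt, this, Real.rpow_neg (by norm_num), Real.rpow_natCast]

theorem wt_nonneg (U : List Bool →. List Bool) (i : ℕ) : 0 ≤ wt U i := by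
  by_cases h : ∃ p : {p : List Bool // (U p).Dom}, Encodable.encode p.1 = i
  · obtain ⟨p, rfl⟩ := h
    rw [wt_enc p.2]; positivity
  · rw [wt, Function.extend_apply' _ _ _ h]; simp

theorem sterm_enc (u : ℕ → List Bool → Option (List Bool)) (t : ℕ) (p : List Bool) :
    sterm u t (Encodable.encode p) =
      if (u t p).isSome = true ∧ p.length ≤ t then 2 ^ (t - p.length) else 0 := by
  simp only [sterm, Encodable.encodek₂, Option.bind_some]
  cases u t p with
  | none => simp
  | some y =>
    by_cases h : p.length ≤ t <;> simp [h]

theorem sterm_ne {u : ℕ → List Bool → Option (List Bool)} {t i : ℕ} (h : sterm u t i ≠ 0) :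
    ∃ p : List Bool, Encodable.encode p = i := by
  cases hd : Encodable.decode₂ (List Bool) i with
  | none => simp [sterm, hd] at h
  | some p => exact ⟨p, Encodable.mem_decode₂.1 hd⟩

section
variable {U : List Bool →. List Bool} {u : ℕ → List Bool → Option (List Bool)}

theorem sterm_le (hc : ∀ a b, b ∈ U a ↔ ∃ t, u t a = some b) (t i : ℕ) :
    (sterm u t i : ℝ) ≤ 2 ^ t * wt U i := by
  by_cases h : sterm u t i = 0
  · rw [h]; have := wt_nonneg U i; simp; positivity
  · obtain ⟨p, rfl⟩ := sterm_ne h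
    rw [sterm_enc] at h ⊢
    split_ifs at h ⊢ with h1
    · obtain ⟨h1, h2⟩ := h1
      obtain ⟨y, hy⟩ := Option.isSome_iff_exists.1 h1
      have hd : (U p).Dom := Part.dom_iff_mem.2 ⟨y, (hc _ _).2 ⟨t, hy⟩⟩
      rw [wt_enc hd]
      push_cast
      rw [pow_sub₀ _ (by norm_num) h2]
    · exact absurd rfl h

theorem sterm_eventually (hm : ∀ s t a b, s ≤ t → u s a = some b → u t a = some b)
    (hc : ∀ a b, b ∈ U a ↔ ∃ t, u t a = some b) (i : ℕ) :
    ∀ᶠ t in Filter.atTop, 2 ^ t * wt U i ≤ (sterm u t i : ℝ) := by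
  by_cases h : ∃ p : {p : List Bool // (U p).Dom}, Encodable.encode p.1 = i
  · obtain ⟨⟨p, hp⟩, rfl⟩ := h
    obtain ⟨y, hy⟩ := Part.dom_iff_mem.1 hp
    obtain ⟨t0, ht0⟩ := (hc _ _).1 hy
    filter_upwards [Filter.eventually_ge_atTop t0, Filter.eventually_ge_atTop p.length] with t h1 h2
    rw [sterm_enc, wt_enc hp, if_pos ⟨by rw [hm _ _ _ _ h1 ht0]; rfl, h2⟩]
    push_cast
    rw [pow_sub₀ _ (by norm_num) h2]
  · rw [wt, Function.extend_apply' _ _ _ h]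
    simp

theorem ssum_complete (hU : IsPrefixFreeMachine U) (hc : ∀ a b, b ∈ U a ↔ ∃ t, u t a = some b)
    {t n v : ℕ} (h1 : v * 2 ^ t < ssum u t * 2 ^ n + 2 ^ t) (hv : Omega U * 2 ^ n < v + 1)
    {q : List Bool} (hq : (U q).Dom) (hqn : q.length + 1 ≤ n) :
    Encodable.encode q < t ∧ (u t q).isSome = true := by
  by_contra hcon
  set e := Encodable.encode q with he
  have key : (ssum u t : ℝ) ≤ 2 ^ t * ∑ i ∈ (Finset.range t).erase e, wt U i := by
    rw [ssum, Finset.mul_sum]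
    push_cast
    have : ∑ i ∈ (Finset.range t).erase e, (sterm u t i : ℝ) =
        ∑ i ∈ Finset.range t, (sterm u t i : ℝ) := by
      refine Finset.sum_subset (Finset.erase_subset _ _) ?_
      intro i hi hi'
      have hie : i = e := by
        by_contra hne
        exact hi' (Finset.mem_erase.2 ⟨hne, hi⟩)
      subst hie
      rw [he, sterm_enc, if_neg]
      · simp
      · intro hh
        exact hcon ⟨Finset.mem_range.1 hi, hh.1⟩
    rw [← this]
    exact Finset.sum_le_sum fun i _ => sterm_le hc t i
  have h2 : wt U e + ∑ i ∈ (Finset.range t).erase e, wt U i ≤ Omega U := by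
    rw [← Finset.sum_insert (Finset.notMem_erase _ _)]
    exact sum_le_hasSum _ (fun i _ => wt_nonneg U i) (wt_hasSum hU)
  rw [he, wt_enc hq, ← he] at h2
  set S := ∑ i ∈ (Finset.range t).erase e, wt U i
  have h1' : (v : ℝ) * 2 ^ t < ssum u t * 2 ^ n + 2 ^ t := by exact_mod_cast h1
  have ht : (0 : ℝ) < 2 ^ t := by positivity
  have hn : (0 : ℝ) < 2 ^ n := by positivity
  have h3 : (v : ℝ) < S * 2 ^ n + 1 := by
    have : (v : ℝ) * 2 ^ t < (S * 2 ^ n + 1) * 2 ^ t := by nlinarith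
    exact lt_of_mul_lt_mul_right this ht.le
  have h4 : (2 : ℝ) ≤ ((2 : ℝ) ^ q.length)⁻¹ * 2 ^ n := by
    rw [inv_mul_eq_div, le_div_iff₀ (by positivity)]
    calc (2 : ℝ) * 2 ^ q.length = 2 ^ (q.length + 1) := by ring
      _ ≤ 2 ^ n := pow_le_pow_right₀ (by norm_num) hqn
  nlinarith

theorem ssum_exists (hU : IsPrefixFreeMachine U)
    (hm : ∀ s t a b, s ≤ t → u s a = some b → u t a = some b)
    (hc : ∀ a b, b ∈ U a ↔ ∃ t, u t a = some b) {n v : ℕ} (hv : v ≤ Omega U * 2 ^ n) :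
    ∀ᶠ t in Filter.atTop, v * 2 ^ t < ssum u t * 2 ^ n + 2 ^ t := by
  have hn : (0 : ℝ) < 2 ^ n := by positivity
  have hlt : Omega U - (2 ^ n)⁻¹ < Omega U := by
    have : (0 : ℝ) < (2 ^ n)⁻¹ := by positivity
    linarith
  obtain ⟨N, hN⟩ := ((wt_hasSum hU).tendsto_sum_nat.eventually (lt_mem_nhds hlt)).exists
  have hall : ∀ᶠ t in Filter.atTop, ∀ i ∈ Finset.range N, 2 ^ t * wt U i ≤ (sterm u t i : ℝ) :=
    (Filter.eventually_all_finset _).2 fun i _ => sterm_eventually hm hc i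
  filter_upwards [hall, Filter.eventually_ge_atTop N] with t h1 h2
  have ht : (0 : ℝ) < 2 ^ t := by positivity
  have h3 : 2 ^ t * ∑ i ∈ Finset.range N, wt U i ≤ (ssum u t : ℝ) := by
    rw [ssum, Finset.mul_sum]
    push_cast
    refine (Finset.sum_le_sum h1).trans ?_
    exact Finset.sum_le_sum_of_subset_of_nonneg (Finset.range_mono h2) (fun _ _ _ => by positivity)
  set S := ∑ i ∈ Finset.range N, wt U i
  have h4 : (v : ℝ) < S * 2 ^ n + 1 := by
    have : (Omega U - (2 ^ n)⁻¹) * 2 ^ n < S * 2 ^ n := mul_lt_mul_of_pos_right hN hn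
    rw [sub_mul, inv_mul_cancel₀ hn.ne'] at this
    linarith
  have : (v : ℝ) * 2 ^ t < ssum u t * 2 ^ n + 2 ^ t := by
    have := mul_lt_mul_of_pos_right h4 ht
    nlinarith
  exact_mod_cast this

end

theorem pre_succ (X : ℕ → Bool) (n : ℕ) : (pre X (n + 1)).reverse = X n :: (pre X n).reverse := by
  simp [pre, List.range_succ]

theorem pre_length (X : ℕ → Bool) (n : ℕ) : (pre X n).reverse.length = n := by
  simp [pre]

theorem bval_pre {α : ℝ} (hα : 0 ≤ α) (n : ℕ) :
    bval ⌊α⌋₊ (pre (fun n => binDigit α n) n).reverse = ⌊α * 2 ^ n⌋₊ := by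
  induction n with
  | zero => simp [pre, bval]
  | succ n ih =>
    rw [pre_succ]
    change 2 * bval _ _ + _ = _
    rw [ih]
    have h1 : α * 2 ^ n = α * 2 ^ (n + 1) / (2 : ℕ) := by push_cast; ring
    rw [h1, Nat.floor_div_natCast]
    have h2 : ⌊α * 2 ^ (n + 1)⌋ = ((⌊α * 2 ^ (n + 1)⌋₊ : ℕ) : ℤ) :=
      (Int.natCast_floor_eq_floor (by positivity)).symm
    simp only [binDigit, h2]
    generalize ⌊α * 2 ^ (n + 1)⌋₊ = k
    by_cases hk : k % 2 = 1
    · have : ((k : ℤ) % 2 = 1) := by omega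
      simp [this]; omega
    · have : ¬ ((k : ℤ) % 2 = 1) := by omega
      simp [this]; omega

theorem desc_pre {F : List Bool →. Option Bool} {X : ℕ → Bool}
    (h1 : ∀ n, (F (pre X n)).Dom)
    (h2 : ∀ n b, some b ∈ F (pre X n) → b = X n)
    (h3 : {n : ℕ | ∃ b, some b ∈ F (pre X n)}.Infinite) (k : ℕ) :
    ∃ n s, Desc (fun r => F r.reverse) (pre X n).reverse s k ∧ ∃ b, some b ∈ F (pre X n) := by
  classical
  set P : ℕ → Prop := fun n => ∃ b, some b ∈ F (pre X n) with hP
  have key : ∀ n, ∃ s, Desc (fun r => F r.reverse) (pre X n).reverse s (Nat.count P n) := by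
    intro n
    induction n with
    | zero => exact ⟨[], by simpa [pre] using Desc.nil⟩
    | succ n ih =>
      obtain ⟨s, hs⟩ := ih
      rw [pre_succ, Nat.count_succ]
      by_cases hp : P n
      · obtain ⟨b, hb⟩ := id hp
        have := h2 n b hb
        subst this
        rw [if_pos hp]
        exact ⟨s, Desc.stepP _ hs (by simpa using hb)⟩
      · rw [if_neg hp]
        obtain ⟨o, ho⟩ := Part.dom_iff_mem.1 (h1 n)
        cases o with
        | none => exact ⟨_, Desc.stepN _ hs (by simpa using ho)⟩
        | some b => exact absurd ⟨b, ho⟩ hp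
  obtain ⟨s, hs⟩ := key (Nat.nth P k)
  rw [Nat.count_nth_of_infinite h3] at hs
  exact ⟨_, s, hs, Nat.nth_mem_of_infinite h3 k⟩

theorem omega_not_stronglyPredictable
    (U : List Bool →. List Bool) (hU : IsOptimalMachine U) :
    ¬ StronglyPredictable (fun n => binDigit (Omega U) n) := by
  rintro ⟨F, hF, h1, h2, h3⟩
  have hF' : Partrec (fun r : List Bool => F r.reverse) :=
    hF.comp Computable.list_reverse
  obtain ⟨g, hg, hgm, hgc⟩ := exists_approx hF'
  obtain ⟨u, hu, hum, huc⟩ := exists_approx hU.1.1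
  have hgs : ∀ t a b, g t a = some b → b ∈ F a.reverse := fun t a b h => (hgc a b).2 ⟨t, h⟩
  have hΩ : 0 ≤ Omega U := tsum_nonneg fun p => by positivity
  have hM := machine_prefixFree (F := fun r => F r.reverse) hg hgs hu ⌊Omega U⌋₊
  obtain ⟨d, hd⟩ := hU.2 _ hM
  obtain ⟨n, s, hD, hb⟩ := desc_pre h1 h2 h3 (2 * (d + 2))
  set X : ℕ → Bool := fun n => binDigit (Omega U) n with hX
  have hbv : bval ⌊Omega U⌋₊ (pre X n).reverse = ⌊Omega U * 2 ^ n⌋₊ := bval_pre hΩ n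
  have hlen := pre_length X n
  have hb' : ∃ b, some b ∈ (fun r : List Bool => F r.reverse) (pre X n).reverse := by
    simpa using hb
  have hΩn : 0 ≤ Omega U * 2 ^ n := by positivity
  -- the machine halts
  have hdom : (Nat.rfindOpt (mfun g u ⌊Omega U⌋₊ (header (d + 2) s))).Dom := by
    rw [Nat.rfindOpt_dom]
    obtain ⟨t0, ht0⟩ := desc_strip hgm hgc hD
    obtain ⟨b, hb1⟩ := hb'
    obtain ⟨t1, ht1⟩ := (hgc _ _).1 hb1
    obtain ⟨t, ha, hbt, hct⟩ := ((Filter.eventually_ge_atTop t0).and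
      ((Filter.eventually_ge_atTop t1).and
        (ssum_exists hU.1 hum huc (Nat.floor_le hΩn)))).exists
    refine ⟨Encodable.encode ((pre X n).reverse, d + 2, t), out u t, ?_⟩
    unfold mfun
    rw [Encodable.encodek, Option.bind_some]
    simp only
    rw [ht0 t ha, Option.bind_some, hgm _ _ _ _ hbt ht1, Option.bind_some, if_pos]
    · rfl
    · refine ⟨rfl, rfl, rfl, ?_⟩
      rw [hlen, hbv]
      exact hct
  obtain ⟨q, hq1, hq2⟩ := hd _ hdom
  obtain ⟨y, hy⟩ := Part.dom_iff_mem.1 hdom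
  obtain ⟨m, hm⟩ := Nat.rfindOpt_spec hy
  obtain ⟨r, s', j, t, d1, d2, e1, e2, rfl⟩ := mfun_spec (F := fun r => F r.reverse) hgs hm
  obtain ⟨rfl, hss⟩ := header_prefix (by rw [e1] : header (d + 2) s <+: header j s')
  obtain rfl := hD.unique d1 hb' d2 hss
  rw [hlen, hbv] at e2
  have hyU : out u t ∈ U q := by rw [hq2]; exact hy
  have hqd : (U q).Dom := Part.dom_iff_mem.2 ⟨_, hyU⟩
  have hl := hD.length
  rw [hlen] at hl
  have hhl : (header (d + 2) s).length = d + 2 + (s.length + 1) := by simp [header]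
  obtain ⟨c1, c2⟩ := ssum_complete hU.1 huc e2 (Nat.lt_floor_add_one _) hqd (by omega)
  obtain ⟨y', hy'⟩ := Option.isSome_iff_exists.1 c2
  have : y' = out u t := Part.mem_unique ((huc _ _).2 ⟨t, hy'⟩) hyU
  subst this
  exact out_ne c1 hy'
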